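/- Let δ, α ∈ F_{q^2} with α ≠ 0 and suppose P_{δ,α}(x) is irreducible in F_{q^2}[x]. Then P_{δ,α} satisfies Condition (1) if and only if (4 − α^{q+1})/(3α^{q+1}) is a nonzero square in F_q, and either δ = 0 or (α + 3δ^{−q})^{q+1} ≠ 1. -/

import Mathlib

noncomputable section

open Polynomial

/-- A polynomial `P` over `F = 𝔽_{q²}`, of degree `m`, satisfies Condition (1). -/
def Condition1 {F : Type*} [Field F] (q m : ℕ) (P : Polynomial F) : Prop :=
  ∀ x y : F, x ≠ 0 → y ≠ 0 →
    (x ^ m * P.eval (x ^ (q - 1))) * (y ^ m * P.eval (y ^ (q - 1))) ^ q =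
      (x ^ m * P.eval (x ^ (q - 1))) ^ q * (y ^ m * P.eval (y ^ (q - 1))) →
    x * y ^ q = x ^ q * y

/-- The cubic `P_{δ,α}(x) = x³ − δx² − (δα + 3α^{1−q})x − (δα²(1 − α^{−(q+1)})/3 + α^{2−q})`. -/
def Pda {F : Type*} [Field F] (q : ℕ) (δ α : F) : Polynomial F :=
  X ^ 3 - C δ * X ^ 2 - C (δ * α + 3 * α ^ ((1 : ℤ) - q)) * X -
    C (δ * α ^ 2 * (1 - α ^ (-((q : ℤ) + 1))) / 3 + α ^ ((2 : ℤ) - q))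

section Involution

variable {F : Type*} [Field F]

/-- The form `x³ P_{δ,α}(x'/x)`, where `x'`, `α'` stand for the conjugates of `x`, `α`. -/
def cubicForm (δ α α' x x' : F) : F :=
  x' ^ 3 - δ * x' ^ 2 * x - (δ * α + 3 * (α / α')) * x' * x ^ 2 -
    (δ * α ^ 2 * (1 - (α * α')⁻¹) / 3 + α ^ 2 / α') * x ^ 3

/-- A symmetric bilinear form in `x` and `y`, invariant under conjugation. -/
def polarForm (α α' x x' y y' : F) : F :=
  2 * x' * y' / α + x' * y + x * y' + 2 * x * y / α'

/-- This vanishes exactly when `P_{δ,α}` is proportional to its conjugate reciprocal. -/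
def degeneracy (δ δ' α α' : F) : F :=
  3 * δ * α' + 9 + 3 * δ' * α + δ * δ' * (α * α' - 1)

theorem map_cubicForm (σ : F →+* F) (hσ : ∀ x, σ (σ x) = x) (δ α x : F) :
    σ (cubicForm δ α (σ α) x (σ x)) = cubicForm (σ δ) (σ α) α (σ x) x := by
  simp [cubicForm, hσ, map_ofNat σ]

theorem cubicForm_wronskian (h2 : (2 : F) ≠ 0) (h3 : (3 : F) ≠ 0) {δ δ' α α' : F}
    (hα : α ≠ 0) (hα' : α' ≠ 0) (x x' y y' : F) :
    cubicForm δ α α' x x' * cubicForm δ' α' α y' y -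
        cubicForm δ' α' α x' x * cubicForm δ α α' y y' =
      degeneracy δ δ' α α' * (α * α') / 12 * (x * y' - x' * y) *
        (polarForm α α' x x' y y' ^ 2 -
          (4 - α * α') / (3 * (α * α')) * (x * y' - x' * y) ^ 2) := by
  have h12 : (12 : F) ≠ 0 := by
    rw [show (12 : F) = 2 * 2 * 3 by norm_num]
    exact mul_ne_zero (mul_ne_zero h2 h2) h3
  unfold cubicForm polarForm degeneracy
  field_simp
  ring

theorem degeneracy_ne_zero_iff (h3 : (3 : F) ≠ 0) {δ δ' α α' : F} (hδ : δ' = 0 ↔ δ = 0) :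
    degeneracy δ δ' α α' ≠ 0 ↔ δ = 0 ∨ (α + 3 * δ'⁻¹) * (α' + 3 * δ⁻¹) ≠ 1 := by
  by_cases h : δ = 0
  · have h9 : (9 : F) ≠ 0 := by
      rw [show (9 : F) = 3 * 3 by norm_num]
      exact mul_ne_zero h3 h3
    simp [degeneracy, h, hδ.2 h, h9]
  · have h' : δ' ≠ 0 := fun h0 => h (hδ.1 h0)
    have key : degeneracy δ δ' α α' =
        δ * δ' * ((α + 3 * δ'⁻¹) * (α' + 3 * δ⁻¹) - 1) := by
      unfold degeneracy
      field_simp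
      ring
    simp [key, h, h', sub_eq_zero]

/-- If `T² = s² Z²` with `T` and `s ≠ 0` fixed by `σ` and `Z` negated by `σ`, then `Z = 0`; here
`T` is `polarForm` and `Z` is `x σ(y) - σ(x) y`. -/
theorem polarForm_eq_imp (h2 : (2 : F) ≠ 0) (σ : F →+* F) (hσ : ∀ x, σ (σ x) = x)
    {α x y s : F} (hs : σ s = s) (hs0 : s ≠ 0)
    (h : polarForm α (σ α) x (σ x) y (σ y) ^ 2 - s ^ 2 * (x * σ y - σ x * y) ^ 2 = 0) :
    x * σ y = σ x * y := by
  have hT : σ (polarForm α (σ α) x (σ x) y (σ y)) = polarForm α (σ α) x (σ x) y (σ y) := by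
    simp only [polarForm, map_add, map_mul, map_div₀, map_ofNat, hσ]
    ring
  have hZ : σ (s * (x * σ y - σ x * y)) = -(s * (x * σ y - σ x * y)) := by
    simp only [map_sub, map_mul, hσ, hs]
    ring
  have h0 : s * (x * σ y - σ x * y) = 0 := by
    have hfix : σ (s * (x * σ y - σ x * y)) = s * (x * σ y - σ x * y) := by
      rcases sq_eq_sq_iff_eq_or_eq_neg.1
        (show polarForm α (σ α) x (σ x) y (σ y) ^ 2 = (s * (x * σ y - σ x * y)) ^ 2 by
          linear_combination h) with h | h
      · rw [← h, hT]
      · rw [← neg_eq_iff_eq_neg.2 h, map_neg, hT]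
    have : 2 * (s * (x * σ y - σ x * y)) = 0 := by linear_combination hZ - hfix
    exact (mul_eq_zero.1 this).resolve_left h2
  exact sub_eq_zero.1 ((mul_eq_zero.1 h0).resolve_left hs0)

theorem exists_polarForm_eq (h2 : (2 : F) ≠ 0) (σ : F →+* F) (hσ : ∀ x, σ (σ x) = x)
    {α e : F} (hα : α ≠ 0) (he : σ e = -e) (he0 : e ≠ 0) :
    ∃ x y : F, x ≠ 0 ∧ y ≠ 0 ∧ x * σ y ≠ σ x * y ∧
      polarForm α (σ α) x (σ x) y (σ y) = e * (x * σ y - σ x * y) := by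
  have hα' : σ α ≠ 0 := (map_ne_zero σ).2 hα
  obtain ⟨x, hx⟩ : ∃ x : F, x * σ x + x ^ 2 / σ α + σ x ^ 2 / α ≠ 0 := by
    by_contra! hcon
    have h1 := hcon 1
    have h2' := hcon e
    rw [map_one] at h1
    rw [he] at h2'
    have : 2 * e ^ 2 = 0 := by linear_combination e ^ 2 * h1 - h2'
    simp [h2, he0] at this
  have hZ : x * σ (e * (x + 2 * σ x / α - e * x)) - σ x * (e * (x + 2 * σ x / α - e * x)) =
      -(2 * e) * (x * σ x + x ^ 2 / σ α + σ x ^ 2 / α) := by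
    simp only [map_sub, map_add, map_mul, map_div₀, map_ofNat, hσ, he]
    ring
  have hne : x * σ (e * (x + 2 * σ x / α - e * x)) ≠ σ x * (e * (x + 2 * σ x / α - e * x)) := by
    rw [← sub_ne_zero, hZ]
    exact mul_ne_zero (neg_ne_zero.2 (mul_ne_zero h2 he0)) hx
  refine ⟨x, e * (x + 2 * σ x / α - e * x), ?_, ?_, hne, ?_⟩
  · rintro rfl
    simp at hx
  · intro h
    simp [h] at hne
  · simp only [polarForm, map_sub, map_add, map_mul, map_div₀, map_ofNat, hσ, he]
    field_simp
    ring

end Involution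

theorem eval_Pda {F : Type*} [Field F] (q : ℕ) {δ α : F} (hα : α ≠ 0) (z : F) :
    (Pda q δ α).eval z = cubicForm δ α (α ^ q) 1 z := by
  have h1 : α ^ ((1 : ℤ) - q) = α / α ^ q := by
    rw [zpow_sub₀ hα, zpow_one, zpow_natCast]
  have h2 : α ^ ((2 : ℤ) - q) = α ^ 2 / α ^ q := by
    rw [zpow_sub₀ hα, zpow_natCast, zpow_ofNat]
  have h3 : α ^ (-((q : ℤ) + 1)) = (α * α ^ q)⁻¹ := by
    rw [zpow_neg, zpow_add₀ hα, zpow_natCast, zpow_one, mul_comm]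
  simp only [Pda, h1, h2, h3]
  simp [cubicForm]

theorem pow_mul_eval_Pda {F : Type*} [Field F] {q : ℕ} (hq : q ≠ 0) {δ α : F} (hα : α ≠ 0)
    (x : F) :
    x ^ 3 * (Pda q δ α).eval (x ^ (q - 1)) = cubicForm δ α (α ^ q) x (x ^ q) := by
  rw [eval_Pda q hα, ← pow_sub_one_mul hq x]
  unfold cubicForm
  ring

theorem natDegree_Pda {F : Type*} [Field F] (q : ℕ) (δ α : F) :
    (Pda q δ α).natDegree = 3 := by
  unfold Pda
  compute_degree!

/-- If `α^{q+1} = 4`, then `-α/2` is a root. -/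
theorem ne_four_of_irreducible {F : Type*} [Field F] (h2 : (2 : F) ≠ 0) (h3 : (3 : F) ≠ 0)
    {q : ℕ} {δ α : F} (hα : α ≠ 0) (hP : Irreducible (Pda q δ α)) : 4 - α * α ^ q ≠ 0 := by
  intro h
  have h4 : (4 : F) ≠ 0 := by
    rw [show (4 : F) = 2 * 2 by norm_num]
    exact mul_ne_zero h2 h2
  have hα' : α ^ q = 4 / α := by
    rw [eq_div_iff hα]
    linear_combination -h
  have hroot : (Pda q δ α).IsRoot (-α / 2) := by
    rw [IsRoot.def, eval_Pda q hα, hα', cubicForm]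
    field_simp
    ring
  exact hP.not_isRoot_of_natDegree_ne_one (by simp [natDegree_Pda]) hroot

theorem exists_pow_ne_self {F : Type*} [Field F] [Fintype F] {q : ℕ} (hq : 1 < q)
    (hF : q < Fintype.card F) : ∃ x : F, x ^ q ≠ x := by
  by_contra! h
  have hne : (X ^ q - X : F[X]) ≠ 0 := FiniteField.X_pow_card_sub_X_ne_zero F hq
  have hle := (X ^ q - X : F[X]).card_le_degree_of_subset_roots (Z := Finset.univ)
    fun x _ => by simp [hne, h x]
  rw [FiniteField.X_pow_card_sub_X_natDegree_eq F hq] at hle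
  exact hF.not_ge hle

theorem exists_sq_eq_of_pow_eq_self {F : Type*} [Field F] [Fintype F] {q : ℕ}
    (hodd : Odd q) (hF : Fintype.card F = q ^ 2) (h2 : (2 : F) ≠ 0) {a : F} (ha : a ^ q = a) :
    ∃ e : F, e ^ 2 = a := by
  by_cases ha0 : a = 0
  · exact ⟨0, by simp [ha0]⟩
  have hchar : ringChar F ≠ 2 := fun h => h2 (by
    have := ringChar.Nat.cast_ringChar (R := F)
    rwa [h] at this)
  obtain ⟨k, hk⟩ := hodd
  have h1 : a ^ (2 * k) = 1 := by
    rw [hk, pow_succ] at ha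
    exact mul_right_cancel₀ ha0 (by rw [ha, one_mul])
  have hcard : Fintype.card F / 2 = 2 * k * (k + 1) := by
    rw [hF, hk, show (2 * k + 1) ^ 2 = 2 * (2 * k * (k + 1)) + 1 by ring]
    omega
  have hsq : IsSquare a := by
    rw [FiniteField.isSquare_iff hchar ha0, hcard, pow_mul, h1, one_pow]
  obtain ⟨e, rfl⟩ := hsq
  exact ⟨e, sq e⟩

/-- Theorem: for `α ≠ 0` with `P_{δ,α}` irreducible, `P_{δ,α}` satisfies Condition (1) iff
`(4 − α^{q+1})/(3α^{q+1})` is a nonzero square in `𝔽_q`, and `δ = 0` or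
`(α + 3δ^{−q})^{q+1} ≠ 1`. -/
theorem statement12 (p n q : ℕ) (hp : p.Prime) (hp3 : 3 < p) (hn : n ≠ 0) (hq : q = p ^ n)
    (F : Type*) [Field F] [Fintype F] (hF : Fintype.card F = q ^ 2)
    (δ α : F) (hα : α ≠ 0) (hPirr : Irreducible (Pda q δ α)) :
    Condition1 q 3 (Pda q δ α) ↔
      (((4 - α ^ (q + 1)) / (3 * α ^ (q + 1)) ≠ 0 ∧
          ∃ s : F, s ^ q = s ∧ s ^ 2 = (4 - α ^ (q + 1)) / (3 * α ^ (q + 1))) ∧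
        (δ = 0 ∨ (α + 3 * (δ ^ q)⁻¹) ^ (q + 1) ≠ 1)) := by
  have hp2 : p ≠ 2 := by omega
  have hodd : Odd q := hq ▸ (hp.odd_of_ne_two hp2).pow
  have hq1 : 1 < q := hq ▸ Nat.one_lt_pow hn hp.one_lt
  have hq0 : q ≠ 0 := by omega
  have : Fact p.Prime := ⟨hp⟩
  have : CharP F p := charP_of_card_eq_prime_pow (f := n * 2)
    (by rw [← Nat.card_eq_fintype_card] at hF ⊢; rw [hF, hq, pow_mul])
  have hcast : ∀ m : ℕ, 0 < m → m < p → (m : F) ≠ 0 := fun m hm hmp h =>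
    Nat.not_dvd_of_pos_of_lt hm hmp ((CharP.cast_eq_zero_iff F p m).1 h)
  have h2 : (2 : F) ≠ 0 := by exact_mod_cast hcast 2 (by omega) (by omega)
  have h3 : (3 : F) ≠ 0 := by exact_mod_cast hcast 3 (by omega) hp3
  have h12 : (12 : F) ≠ 0 := by
    rw [show (12 : F) = 2 * 2 * 3 by norm_num]
    exact mul_ne_zero (mul_ne_zero h2 h2) h3
  obtain ⟨σ, hσq⟩ : ∃ σ : F →+* F, ∀ x, x ^ q = σ x :=
    ⟨iterateFrobenius F p n, fun x => by rw [iterateFrobenius_def, hq]⟩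
  have hσ : ∀ x, σ (σ x) = x := fun x => by
    rw [← hσq, ← hσq, ← pow_mul, ← sq, ← hF, FiniteField.pow_card]
  have hα' : σ α ≠ 0 := (map_ne_zero σ).2 hα
  have h4 := ne_four_of_irreducible h2 h3 hα hPirr
  have hcond : Condition1 q 3 (Pda q δ α) ↔ ∀ x y : F, x ≠ 0 → y ≠ 0 →
      degeneracy δ (σ δ) α (σ α) * (α * σ α) / 12 * (x * σ y - σ x * y) *
        (polarForm α (σ α) x (σ x) y (σ y) ^ 2 -
          (4 - α * σ α) / (3 * (α * σ α)) * (x * σ y - σ x * y) ^ 2) = 0 →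
      x * σ y = σ x * y := by
    simp only [Condition1, pow_mul_eval_Pda hq0 hα, hσq, map_cubicForm σ hσ,
      ← cubicForm_wronskian h2 h3 hα hα', sub_eq_zero]
  have hdeg : (δ = 0 ∨ (α + 3 * (δ ^ q)⁻¹) ^ (q + 1) ≠ 1) ↔
      degeneracy δ (σ δ) α (σ α) ≠ 0 := by
    rw [degeneracy_ne_zero_iff h3 (map_eq_zero σ), pow_succ', hσq, hσq]
    simp [hσ, map_ofNat σ]
  rw [hcond, hdeg, pow_succ', hσq]
  rw [hσq] at h4
  have hE0 : (4 - α * σ α) / (3 * (α * σ α)) ≠ 0 :=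
    div_ne_zero h4 (mul_ne_zero h3 (mul_ne_zero hα hα'))
  have hEfix : σ ((4 - α * σ α) / (3 * (α * σ α))) = (4 - α * σ α) / (3 * (α * σ α)) := by
    simp [hσ, map_ofNat σ, mul_comm]
  generalize (4 - α * σ α) / (3 * (α * σ α)) = E at hE0 hEfix ⊢
  constructor
  · intro h
    have hD : degeneracy δ (σ δ) α (σ α) ≠ 0 := by
      intro hD
      obtain ⟨y, hy⟩ := exists_pow_ne_self (F := F) hq1
        (by rw [hF, sq]; exact lt_mul_of_one_lt_left (by omega) hq1)
      have hy0 : y ≠ 0 := by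
        rintro rfl
        simp [hq0] at hy
      refine hy ?_
      simpa [hσq] using h 1 y one_ne_zero hy0 (by simp [hD])
    refine ⟨⟨hE0, ?_⟩, hD⟩
    obtain ⟨e, he⟩ := exists_sq_eq_of_pow_eq_self hodd hF h2 ((hσq E).trans hEfix)
    refine ⟨e, ?_, he⟩
    have he0 : e ≠ 0 := by
      rintro rfl
      simp [← he] at hE0
    rw [hσq]
    rcases sq_eq_sq_iff_eq_or_eq_neg.1 (show σ e ^ 2 = e ^ 2 by rw [← map_pow, he, hEfix])
      with h' | h'
    · exact h'
    · obtain ⟨x, y, hx, hy, hne, hT⟩ := exists_polarForm_eq h2 σ hσ hα h' he0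
      refine absurd (h x y hx hy ?_) hne
      rw [hT, ← he]
      ring
  · rintro ⟨⟨-, s, hs, rfl⟩, hD⟩ x y - - h
    have hs0 : s ≠ 0 := by
      rintro rfl
      simp at hE0
    have hK : degeneracy δ (σ δ) α (σ α) * (α * σ α) / 12 ≠ 0 :=
      div_ne_zero (mul_ne_zero hD (mul_ne_zero hα hα')) h12
    rcases mul_eq_zero.1 h with h | h
    · exact sub_eq_zero.1 ((mul_eq_zero.1 h).resolve_left hK)
    · exact polarForm_eq_imp h2 σ hσ ((hσq s).symm.trans hs) hs0 h
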